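/- Let φ(x) = e^{-2|x|}, with Fourier transform φ̂(ξ) = 4/(√(2π)(ξ²+4)), and let (α_j)_{j≥1} be positive reals with ∑_{j=1}^∞ α_j e^{4j} < ∞. For s ∈ ℝ define (W(s)φ)(x) := (2π)^{-1/2} ∫_ℝ e^{ixξ} e^{-isξ⁵} φ̂(ξ) dξ, so that W(0)φ = φ. Then for every positive integer n, the series v_n(x) := ∑_{j=1}^∞ α_j (W(n-j)φ)(x) converges for every x ∈ ℝ, the resulting function v_n is continuously differentiable on ℝ \ {0}, but v_n is not continuously differentiable on ℝ (it fails to be C¹ at x = 0). -/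

import Mathlib

open MeasureTheory
open scoped Real

/-- The Fourier transform of `φ(x) = e^{-2|x|}`: `φ̂(ξ) = 4/(√(2π)(ξ²+4))`. -/
noncomputable def phiHat (ξ : ℝ) : ℂ :=
  ((4 / (Real.sqrt (2 * π) * (ξ ^ 2 + 4)) : ℝ) : ℂ)

/-- `(W(s)φ)(x) = (2π)^{-1/2} ∫ e^{ixξ} e^{-isξ⁵} φ̂(ξ) dξ`. -/
noncomputable def Wphi (s : ℝ) (x : ℝ) : ℂ :=
  (Real.sqrt (2 * π) : ℂ)⁻¹ *
    ∫ ξ : ℝ, Complex.exp (Complex.I * (x * ξ - s * ξ ^ 5)) * phiHat ξ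

namespace DispBlow

open Filter Topology

/-- The oscillating kernel. -/
noncomputable def ker (s x ξ : ℝ) : ℂ := Complex.exp (Complex.I * (x * ξ - s * ξ ^ 5))

/-- The auxiliary weight. -/
noncomputable def bw (ξ : ℝ) : ℝ := 1 / ((ξ ^ 2 + 4) * (1 + ξ ^ 4))

/-- Its derivative. -/
noncomputable def bw' (ξ : ℝ) : ℝ :=
  -(2 * ξ * (1 + ξ ^ 4) + (ξ ^ 2 + 4) * (4 * ξ ^ 3)) / ((ξ ^ 2 + 4) * (1 + ξ ^ 4)) ^ 2

lemma norm_ker (s x ξ : ℝ) : ‖ker s x ξ‖ = 1 := by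
  have : ker s x ξ = Complex.exp (((x * ξ - s * ξ ^ 5 : ℝ) : ℂ) * Complex.I) := by
    unfold ker; push_cast; ring_nf
  rw [this, Complex.norm_exp_ofReal_mul_I]

lemma continuous_ker (s x : ℝ) : Continuous (ker s x) := by
  unfold ker; fun_prop

lemma den_pos (ξ : ℝ) : 0 < (ξ ^ 2 + 4) * (1 + ξ ^ 4) := by positivity

lemma bw_pos (ξ : ℝ) : 0 < bw ξ := by unfold bw; positivity

lemma continuous_bw : Continuous bw := by
  unfold bw
  exact continuous_const.div (by fun_prop) (fun ξ => (den_pos ξ).ne')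

lemma continuous_bw' : Continuous bw' := by
  unfold bw'
  exact Continuous.div (by fun_prop) (by fun_prop) (fun ξ => (pow_pos (den_pos ξ) 2).ne')

lemma hasDerivAt_bw (ξ : ℝ) : HasDerivAt bw (bw' ξ) ξ := by
  have h1 : HasDerivAt (fun ξ : ℝ => ξ ^ 2 + 4) (2 * ξ) ξ := by
    simpa using (hasDerivAt_pow 2 ξ).add_const 4
  have h2 : HasDerivAt (fun ξ : ℝ => 1 + ξ ^ 4) (4 * ξ ^ 3) ξ := by
    simpa using (hasDerivAt_pow 4 ξ).const_add 1
  have h3 := (h1.mul h2).inv (den_pos ξ).ne'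
  have : bw = ((fun ξ : ℝ => ξ ^ 2 + 4) * (fun ξ : ℝ => 1 + ξ ^ 4) : ℝ → ℝ)⁻¹ := by
    funext y; simp only [bw, Pi.inv_apply, Pi.mul_apply, one_div]
  rw [this]
  exact h3

lemma abs_bw'_le (ξ : ℝ) : |bw' ξ| ≤ 5 * bw ξ := by
  unfold bw' bw
  have hp := den_pos ξ
  rw [abs_div, abs_of_pos (pow_pos hp 2), abs_neg, mul_one_div, div_le_div_iff₀ (pow_pos hp 2) hp,
    pow_two ((ξ ^ 2 + 4) * (1 + ξ ^ 4)), ← mul_assoc 5]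
  refine mul_le_mul_of_nonneg_right ?_ hp.le
  have h1 : |2 * ξ| ≤ ξ ^ 2 + 4 := by
    rw [abs_le]; constructor <;> nlinarith [sq_nonneg (ξ - 1), sq_nonneg (ξ + 1)]
  have h2 : |4 * ξ ^ 3| ≤ 4 * (1 + ξ ^ 4) := by
    rw [abs_le]
    constructor <;>
      nlinarith [sq_nonneg (ξ ^ 2 - ξ), sq_nonneg (ξ ^ 2 + ξ), sq_nonneg (ξ ^ 2 - 1),
        sq_nonneg (ξ - 1), sq_nonneg (ξ + 1), sq_nonneg ξ]
  calc |2 * ξ * (1 + ξ ^ 4) + (ξ ^ 2 + 4) * (4 * ξ ^ 3)|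
      ≤ |2 * ξ * (1 + ξ ^ 4)| + |(ξ ^ 2 + 4) * (4 * ξ ^ 3)| := abs_add_le _ _
    _ = |2 * ξ| * (1 + ξ ^ 4) + (ξ ^ 2 + 4) * |4 * ξ ^ 3| := by
        rw [abs_mul (2 * ξ), abs_mul (ξ ^ 2 + 4), abs_of_pos (by positivity : 0 < 1 + ξ ^ 4),
          abs_of_pos (by positivity : 0 < ξ ^ 2 + 4)]
    _ ≤ (ξ ^ 2 + 4) * (1 + ξ ^ 4) + (ξ ^ 2 + 4) * (4 * (1 + ξ ^ 4)) := by gcongr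
    _ = 5 * ((ξ ^ 2 + 4) * (1 + ξ ^ 4)) := by ring

lemma bw_le (ξ : ℝ) : bw ξ ≤ (1 + ξ ^ 2)⁻¹ := by
  unfold bw
  rw [← one_div]
  apply one_div_le_one_div_of_le (by positivity)
  nlinarith [sq_nonneg ξ, sq_nonneg (ξ ^ 2), mul_nonneg (sq_nonneg ξ) (sq_nonneg (ξ ^ 2))]

lemma abs_mul_bw_le (ξ : ℝ) : |ξ| * bw ξ ≤ (1 + ξ ^ 2)⁻¹ := by
  unfold bw
  rw [← one_div, mul_one_div, div_le_div_iff₀ (den_pos ξ) (by positivity), ← sq_abs ξ]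
  have : ξ ^ 4 = |ξ| ^ 4 := by rw [← abs_pow]; exact (abs_of_nonneg (by positivity)).symm
  rw [this]
  have h0 := abs_nonneg ξ
  generalize |ξ| = t at *
  have : t ≤ 1 + t ^ 4 := by
    nlinarith [sq_nonneg (t ^ 2 - 1), sq_nonneg (t - 1), sq_nonneg t, sq_nonneg (t ^ 2)]
  have h2 : 1 + t ^ 2 ≤ t ^ 2 + 4 := by linarith
  calc t * (1 + t ^ 2) ≤ (1 + t ^ 4) * (t ^ 2 + 4) := by gcongr
    _ = _ := by ring

lemma integrable_bw : Integrable bw := by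
  refine integrable_inv_one_add_sq.mono' continuous_bw.aestronglyMeasurable (ae_of_all _ fun ξ => ?_)
  rw [Real.norm_eq_abs, abs_of_pos (bw_pos ξ)]
  exact bw_le ξ

lemma integrable_abs_mul_bw : Integrable (fun ξ => |ξ| * (5 * bw ξ)) := by
  have : Integrable (fun ξ => |ξ| * bw ξ) := by
    refine integrable_inv_one_add_sq.mono' (continuous_abs.mul continuous_bw).aestronglyMeasurable
      (ae_of_all _ fun ξ => ?_)
    rw [Real.norm_eq_abs, abs_of_nonneg (mul_nonneg (abs_nonneg _) (bw_pos ξ).le)]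
    exact abs_mul_bw_le ξ
  refine (this.const_mul 5).congr (ae_of_all _ fun ξ => ?_)
  simp only; ring

/-- The oscillatory integral against an amplitude. -/
noncomputable def osc (g : ℝ → ℂ) (s x : ℝ) : ℂ := ∫ ξ : ℝ, ker s x ξ * g ξ

lemma integrable_amp {g : ℝ → ℂ} (hg : Continuous g) (hb : ∀ ξ, ‖g ξ‖ ≤ 5 * bw ξ)
    (s x : ℝ) : Integrable (fun ξ => ker s x ξ * g ξ) := by
  refine (integrable_bw.const_mul 5).mono'
    ((continuous_ker s x).mul hg).aestronglyMeasurable (ae_of_all _ fun ξ => ?_)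
  rw [norm_mul, norm_ker, one_mul]; exact hb ξ

lemma norm_osc_le {g : ℝ → ℂ} (hb : ∀ ξ, ‖g ξ‖ ≤ 5 * bw ξ)
    (s x : ℝ) : ‖osc g s x‖ ≤ ∫ ξ, 5 * bw ξ := by
  refine norm_integral_le_of_norm_le (integrable_bw.const_mul 5) (ae_of_all _ fun ξ => ?_)
  rw [norm_mul, norm_ker, one_mul]; exact hb ξ

lemma norm_dosc_pt {g : ℝ → ℂ} (hb : ∀ ξ, ‖g ξ‖ ≤ 5 * bw ξ)
    (s x ξ : ℝ) : ‖ker s x ξ * (Complex.I * ξ) * g ξ‖ ≤ |ξ| * (5 * bw ξ) := by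
  rw [norm_mul, norm_mul, norm_ker, one_mul, norm_mul, Complex.norm_I, one_mul, Complex.norm_real]
  exact mul_le_mul_of_nonneg_left (hb ξ) (abs_nonneg _)

lemma hasDerivAt_osc {g : ℝ → ℂ} (hg : Continuous g) (hb : ∀ ξ, ‖g ξ‖ ≤ 5 * bw ξ)
    (s x : ℝ) :
    HasDerivAt (osc g s) (∫ ξ, ker s x ξ * (Complex.I * ξ) * g ξ) x := by
  refine (hasDerivAt_integral_of_dominated_loc_of_deriv_le (s := Set.univ)
    (F := fun x ξ => ker s x ξ * g ξ) (F' := fun x ξ => ker s x ξ * (Complex.I * ξ) * g ξ)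
    (bound := fun ξ => |ξ| * (5 * bw ξ)) univ_mem
    (Eventually.of_forall fun y => (integrable_amp hg hb s y).aestronglyMeasurable)
    (integrable_amp hg hb s x) ?_ (ae_of_all _ fun ξ y _ => norm_dosc_pt hb s y ξ)
    integrable_abs_mul_bw (ae_of_all _ fun ξ y _ => ?_)).2
  · exact (((continuous_ker s x).mul (by fun_prop)).mul hg).aestronglyMeasurable
  · refine HasDerivAt.mul_const ?_ _
    unfold ker
    refine HasDerivAt.cexp ?_
    have h : HasDerivAt (fun y : ℝ => (y : ℂ)) 1 y := Complex.ofRealCLM.hasDerivAt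
    simpa using ((h.mul_const (ξ : ℂ)).sub_const ((s : ℂ) * ξ ^ 5)).const_mul Complex.I

lemma norm_dosc_le {g : ℝ → ℂ} (hb : ∀ ξ, ‖g ξ‖ ≤ 5 * bw ξ)
    (s x : ℝ) :
    ‖∫ ξ, ker s x ξ * (Complex.I * ξ) * g ξ‖ ≤ ∫ ξ, |ξ| * (5 * bw ξ) :=
  norm_integral_le_of_norm_le integrable_abs_mul_bw (ae_of_all _ fun ξ => norm_dosc_pt hb s x ξ)

lemma contDiff_osc {g : ℝ → ℂ} (hg : Continuous g) (hb : ∀ ξ, ‖g ξ‖ ≤ 5 * bw ξ)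
    (s : ℝ) : ContDiff ℝ 1 (osc g s) := by
  rw [contDiff_one_iff_deriv]
  refine ⟨fun x => (hasDerivAt_osc hg hb s x).differentiableAt, ?_⟩
  have : deriv (osc g s) = fun x => ∫ ξ, ker s x ξ * (Complex.I * ξ) * g ξ :=
    funext fun x => (hasDerivAt_osc hg hb s x).deriv
  rw [this]
  refine continuous_of_dominated (bound := fun ξ => |ξ| * (5 * bw ξ)) (fun x => ?_)
    (fun x => ae_of_all _ fun ξ => norm_dosc_pt hb s x ξ) integrable_abs_mul_bw
    (ae_of_all _ fun ξ => ?_)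
  · exact (((continuous_ker s x).mul (by fun_prop)).mul hg).aestronglyMeasurable
  · unfold ker; fun_prop

lemma summable_osc {g : ℝ → ℂ} (hb : ∀ ξ, ‖g ξ‖ ≤ 5 * bw ξ)
    (c : ℕ → ℂ) (hc : Summable fun j => ‖c j‖) (s : ℕ → ℝ) (x : ℝ) :
    Summable fun j => c j * osc g (s j) x := by
  refine Summable.of_norm_bounded (hc.mul_right (∫ ξ, 5 * bw ξ)) fun j => ?_
  rw [norm_mul]
  exact mul_le_mul_of_nonneg_left (norm_osc_le hb _ _) (norm_nonneg _)

lemma contDiff_series {g : ℝ → ℂ} (hg : Continuous g) (hb : ∀ ξ, ‖g ξ‖ ≤ 5 * bw ξ)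
    (c : ℕ → ℂ) (hc : Summable fun j => ‖c j‖) (s : ℕ → ℝ) :
    ContDiff ℝ 1 fun x => ∑' j, c j * osc g (s j) x := by
  have := contDiff_tsum (𝕜 := ℝ) (N := 1) (f := fun j x => c j * osc g (s j) x)
    (v := fun k j => if k = 0 then ‖c j‖ * ∫ ξ, 5 * bw ξ else ‖c j‖ * ∫ ξ, |ξ| * (5 * bw ξ))
    (fun j => contDiff_const.mul (contDiff_osc hg hb (s j))) ?_ ?_
  · exact_mod_cast this
  · intro k _
    by_cases hk : k = 0
    · simp only [hk, if_true]; exact hc.mul_right _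
    · simp only [hk, if_false]; exact hc.mul_right _
  · intro k j x hk
    rw [norm_iteratedFDeriv_eq_norm_iteratedDeriv]
    have hk' : k ≤ 1 := by exact_mod_cast hk
    interval_cases k
    · simp only [iteratedDeriv_zero, if_true, norm_mul]
      exact mul_le_mul_of_nonneg_left (norm_osc_le hb _ _) (norm_nonneg _)
    · rw [iteratedDeriv_one, ((hasDerivAt_osc hg hb (s j) x).const_mul (c j)).deriv, norm_mul]
      simp only [one_ne_zero, if_false]
      exact mul_le_mul_of_nonneg_left (norm_dosc_le hb _ _) (norm_nonneg _)

lemma cont_b : Continuous fun ξ => (bw ξ : ℂ) := Complex.continuous_ofReal.comp continuous_bw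
lemma cont_b' : Continuous fun ξ => (bw' ξ : ℂ) := Complex.continuous_ofReal.comp continuous_bw'
lemma bd_b (ξ : ℝ) : ‖(bw ξ : ℂ)‖ ≤ 5 * bw ξ := by
  rw [Complex.norm_real, Real.norm_eq_abs, abs_of_pos (bw_pos ξ)]; linarith [bw_pos ξ]
lemma bd_b' (ξ : ℝ) : ‖(bw' ξ : ℂ)‖ ≤ 5 * bw ξ := by
  rw [Complex.norm_real, Real.norm_eq_abs]; exact abs_bw'_le ξ

/-- The rational symbol. -/
noncomputable def rs (ξ : ℝ) : ℝ := 1 / (ξ ^ 2 + 4)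

lemma continuous_rs : Continuous rs := by
  unfold rs
  exact continuous_const.div (by fun_prop) (fun ξ => by positivity)

lemma integrable_rs : Integrable rs := by
  refine integrable_inv_one_add_sq.mono' continuous_rs.aestronglyMeasurable (ae_of_all _ fun ξ => ?_)
  have h : 0 < rs ξ := by unfold rs; positivity
  rw [Real.norm_eq_abs, abs_of_pos h, rs, ← one_div]
  apply one_div_le_one_div_of_le (by positivity)
  linarith

lemma integrable_ker_rs (s x : ℝ) : Integrable (fun ξ => ker s x ξ * (rs ξ : ℂ)) := by
  refine integrable_rs.norm.mono' ((continuous_ker s x).mul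
    (Complex.continuous_ofReal.comp continuous_rs)).aestronglyMeasurable (ae_of_all _ fun ξ => ?_)
  rw [norm_mul, norm_ker, one_mul, Complex.norm_real]

lemma rs_eq (ξ : ℝ) : rs ξ = bw ξ + ξ ^ 4 * bw ξ := by
  unfold rs bw
  have : (1 : ℝ) + ξ ^ 4 ≠ 0 := by positivity
  have : (ξ : ℝ) ^ 2 + 4 ≠ 0 := by positivity
  field_simp

lemma Wphi_eq (s x : ℝ) : Wphi s x =
    ((Real.sqrt (2 * π) : ℂ)⁻¹ * (4 / (Real.sqrt (2 * π) : ℂ))) * ∫ ξ, ker s x ξ * (rs ξ : ℂ) := by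
  unfold Wphi
  rw [mul_assoc, ← integral_const_mul (4 / (Real.sqrt (2 * π) : ℂ))]
  congr 1
  refine integral_congr_ae (ae_of_all _ fun ξ => ?_)
  simp only [ker, phiHat, rs]
  push_cast
  rw [div_mul_eq_div_div]
  ring

lemma parts (s x : ℝ) (hs : s ≠ 0) : ∫ ξ, ker s x ξ * (rs ξ : ℂ) =
    osc (fun ξ => (bw ξ : ℂ)) s x + x * ((5 * s : ℂ)⁻¹ * osc (fun ξ => (bw ξ : ℂ)) s x)
      + (5 * s * Complex.I : ℂ)⁻¹ * osc (fun ξ => (bw' ξ : ℂ)) s x := by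
  have hB := integrable_amp cont_b bd_b s x
  have hB' := integrable_amp cont_b' bd_b' s x
  have hR := integrable_ker_rs s x
  have hd : ∀ ξ : ℝ, HasDerivAt (fun ξ => ker s x ξ * (bw ξ : ℂ))
      (Complex.I * (x + 5 * s) * (ker s x ξ * (bw ξ : ℂ)) + ker s x ξ * (bw' ξ : ℂ)
        - 5 * s * Complex.I * (ker s x ξ * (rs ξ : ℂ))) ξ := by
    intro ξ
    have h : HasDerivAt (fun y : ℝ => (y : ℂ)) 1 ξ := Complex.ofRealCLM.hasDerivAt
    have h1 : HasDerivAt (ker s x) (ker s x ξ * (Complex.I * (x - s * (5 * ξ ^ 4)))) ξ := by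
      unfold ker
      refine HasDerivAt.cexp ?_
      have := ((h.const_mul (x : ℂ)).sub ((h.pow 5).const_mul (s : ℂ))).const_mul Complex.I
      simpa using this
    have h2 := h1.mul (hasDerivAt_bw ξ).ofReal_comp
    refine h2.congr_deriv ?_
    rw [rs_eq]; push_cast; ring
  have hz := integral_eq_zero_of_hasDerivAt_of_integrable hd
    (((hB.const_mul _).add hB').sub (hR.const_mul _)) hB
  have hz1 := integral_sub ((hB.const_mul (Complex.I * (x + 5 * s))).add hB')
    (hR.const_mul (5 * s * Complex.I))
  have hz2 := integral_add (hB.const_mul (Complex.I * (x + 5 * s))) hB'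
  simp only [Pi.add_apply] at hz1
  rw [hz1, hz2, integral_const_mul, integral_const_mul] at hz
  unfold osc
  have hs' : (s : ℂ) ≠ 0 := by exact_mod_cast hs
  have hI := Complex.I_ne_zero
  field_simp
  linear_combination (-1) * hz

lemma integrable_f : Integrable (fun t : ℝ => ((Real.exp (-2 * |t|) : ℝ) : ℂ)) := by
  refine Integrable.ofReal (f := fun t : ℝ => Real.exp (-2 * |t|)) ?_
  rw [← integrableOn_univ, ← Set.Iic_union_Ioi (a := (0 : ℝ))]
  refine IntegrableOn.union ?_ ?_
  · refine (integrableOn_exp_mul_Iic (a := 2) (by norm_num) 0).congr_fun (fun t ht => ?_)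
      measurableSet_Iic
    beta_reduce
    rw [abs_of_nonpos ht]; congr 1; ring
  · refine (integrableOn_exp_mul_Ioi (a := -2) (by norm_num) 0).congr_fun (fun t ht => ?_)
      measurableSet_Ioi
    beta_reduce
    rw [abs_of_pos ht]

open scoped FourierTransform in
lemma fourier_f (w : ℝ) : 𝓕 (fun t : ℝ => ((Real.exp (-2 * |t|) : ℝ) : ℂ)) w
    = ((1 / (1 + (π * w) ^ 2) : ℝ) : ℂ) := by
  rw [Real.fourier_real_eq_integral_exp_smul]
  have hint : Integrable (fun v : ℝ =>
      Complex.exp (↑(-2 * π * v * w) * Complex.I) • ((Real.exp (-2 * |v|) : ℝ) : ℂ)) := by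
    refine integrable_f.norm.mono' ?_ (ae_of_all _ fun v => ?_)
    · apply Continuous.aestronglyMeasurable; fun_prop
    · rw [norm_smul, Complex.norm_exp_ofReal_mul_I, one_mul]
  rw [← intervalIntegral.integral_Iic_add_Ioi hint.integrableOn hint.integrableOn (b := 0)]
  have h1 : ∫ v in Set.Iic (0:ℝ), Complex.exp (↑(-2 * π * v * w) * Complex.I) •
      ((Real.exp (-2 * |v|) : ℝ) : ℂ) = ∫ v in Set.Iic (0:ℝ),
        Complex.exp ((2 - 2 * π * w * Complex.I) * v) := by
    refine setIntegral_congr_fun measurableSet_Iic fun v hv => ?_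
    rw [abs_of_nonpos hv, smul_eq_mul, Complex.ofReal_exp, ← Complex.exp_add]
    congr 1; push_cast; ring
  have h2 : ∫ v in Set.Ioi (0:ℝ), Complex.exp (↑(-2 * π * v * w) * Complex.I) •
      ((Real.exp (-2 * |v|) : ℝ) : ℂ) = ∫ v in Set.Ioi (0:ℝ),
        Complex.exp ((-2 - 2 * π * w * Complex.I) * v) := by
    refine setIntegral_congr_fun measurableSet_Ioi fun v hv => ?_
    rw [abs_of_pos hv, smul_eq_mul, Complex.ofReal_exp, ← Complex.exp_add]
    congr 1; push_cast; ring
  have r1 : (2 - 2 * π * w * Complex.I : ℂ).re = 2 := by simp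
  have r2 : (-2 - 2 * π * w * Complex.I : ℂ).re = -2 := by simp
  have n1 : (2 - 2 * π * w * Complex.I : ℂ) ≠ 0 := fun h => by rw [h] at r1; simp at r1
  have n2 : (-2 - 2 * π * w * Complex.I : ℂ) ≠ 0 := fun h => by rw [h] at r2; simp at r2
  have n3 : ((1 : ℂ) + (π * w) ^ 2) ≠ 0 := by
    have : (1 : ℝ) + (π * w) ^ 2 ≠ 0 := by positivity
    exact_mod_cast this
  rw [h1, h2, integral_exp_mul_complex_Iic (by rw [r1]; norm_num),
    integral_exp_mul_complex_Ioi (by rw [r2]; norm_num)]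
  push_cast
  simp only [mul_zero, Complex.exp_zero]
  rw [div_add_div _ _ n1 n2, div_eq_div_iff (mul_ne_zero n1 n2) n3]
  linear_combination (-4 * (π:ℂ)^2 * w^2) * Complex.I_sq

open scoped FourierTransform in
lemma Wphi_zero (x : ℝ) : Wphi 0 x = ((Real.exp (-2 * |x|) : ℝ) : ℂ) := by
  have hF : 𝓕 (fun t : ℝ => ((Real.exp (-2 * |t|) : ℝ) : ℂ))
      = fun w => ((1 / (1 + (π * w) ^ 2) : ℝ) : ℂ) := funext fourier_f
  have hFi : Integrable (𝓕 (fun t : ℝ => ((Real.exp (-2 * |t|) : ℝ) : ℂ))) := by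
    rw [hF]
    refine Integrable.ofReal (𝕜 := ℂ) (f := fun w : ℝ => 1 / (1 + (π * w) ^ 2)) ?_
    have := integrable_inv_one_add_sq.comp_mul_left' Real.pi_ne_zero
    simpa only [one_div] using this
  have hinv := Continuous.fourierInv_fourier_eq
    (f := fun t : ℝ => ((Real.exp (-2 * |t|) : ℝ) : ℂ)) (by fun_prop) integrable_f hFi
  have hx := congrFun hinv x
  rw [← hx, hF, Real.fourierInv_eq', Wphi_eq]
  have hsub := Measure.integral_comp_mul_left (fun ξ => ker 0 x ξ * (rs ξ : ℂ)) (2 * π)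
  have hp : (0 : ℝ) < 2 * π := by positivity
  have hpc : ((2 * π : ℝ) : ℂ) ≠ 0 := by exact_mod_cast hp.ne'
  have hI : ∫ ξ, ker 0 x ξ * (rs ξ : ℂ)
      = ((2 * π : ℝ) : ℂ) * ∫ w : ℝ, ker 0 x (2 * π * w) * (rs (2 * π * w) : ℂ) := by
    rw [hsub, abs_of_pos (inv_pos.2 hp), Complex.real_smul, Complex.ofReal_inv,
      mul_inv_cancel_left₀ hpc]
  have hsq : (Real.sqrt (2 * π) : ℂ) * (Real.sqrt (2 * π) : ℂ) = ((2 * π : ℝ) : ℂ) := by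
    rw [← Complex.ofReal_mul, Real.mul_self_sqrt hp.le]
  have hc : (Real.sqrt (2 * π) : ℂ)⁻¹ * (4 / (Real.sqrt (2 * π) : ℂ)) * ((2 * π : ℝ) : ℂ) = 4 := by
    rw [← hsq]
    have : (Real.sqrt (2 * π) : ℂ) ≠ 0 := by exact_mod_cast (Real.sqrt_pos.2 hp).ne'
    field_simp
  rw [hI, ← mul_assoc, hc, ← integral_const_mul]
  refine integral_congr_ae (ae_of_all _ fun w => ?_)
  simp only [ker, rs, smul_eq_mul]
  have e1 : ((1 / (1 + (π * w) ^ 2) : ℝ) : ℂ) = 4 * ((1 / ((2 * π * w) ^ 2 + 4) : ℝ) : ℂ) := by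
    rw [← Complex.ofReal_ofNat, ← Complex.ofReal_mul]
    congr 1
    have : (1 : ℝ) + (π * w) ^ 2 ≠ 0 := by positivity
    have : (2 * π * w) ^ 2 + 4 ≠ 0 := by positivity
    field_simp; ring
  rw [e1]
  have e2 : Complex.I * ((x : ℂ) * ((2 * π * w : ℝ) : ℂ) - ((0 : ℝ) : ℂ) * ((2 * π * w : ℝ) : ℂ) ^ 5)
      = ((2 * π * inner ℝ w x : ℝ) : ℂ) * Complex.I := by
    simp; ring
  rw [e2]; ring

lemma summable_alpha (α : ℕ → ℝ) (hpos : ∀ j : ℕ, 0 < α j)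
    (hsum : Summable fun j : ℕ => α j * Real.exp (4 * (j + 1))) : Summable α := by
  refine Summable.of_nonneg_of_le (fun j => (hpos j).le) (fun j => ?_) hsum
  exact le_mul_of_one_le_right (hpos j).le (Real.one_le_exp (by positivity))

lemma decomposition (α : ℕ → ℝ) (hpos : ∀ j : ℕ, 0 < α j)
    (hsum : Summable fun j : ℕ => α j * Real.exp (4 * (j + 1))) (m : ℕ) :
    ∃ R : ℝ → ℂ, ContDiff ℝ 1 R ∧ ∀ x : ℝ,
      HasSum (fun j : ℕ => (α j : ℂ) * Wphi (((m + 1 : ℕ) : ℝ) - ((j : ℝ) + 1)) x)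
        (R x + (α m : ℂ) * ((Real.exp (-2 * |x|) : ℝ) : ℂ)) := by
  have hα := summable_alpha α hpos hsum
  set s : ℕ → ℝ := fun j => ((m + 1 : ℕ) : ℝ) - ((j : ℝ) + 1) with hs
  have hs1 : ∀ j, j ≠ m → 1 ≤ |s j| := by
    intro j hj
    have : s j = (((m : ℤ) - (j : ℤ) : ℤ) : ℝ) := by simp [hs]
    rw [this, ← Int.cast_abs]
    exact_mod_cast Int.one_le_abs (z := (m : ℤ) - j) (by omega)
  have hs0 : s m = 0 := by simp [hs]
  set κ : ℂ := (Real.sqrt (2 * π) : ℂ)⁻¹ * (4 / (Real.sqrt (2 * π) : ℂ)) with hκ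
  let c : ℕ → ℂ := fun j => if j = m then 0 else κ * α j
  let d : ℕ → ℂ := fun j => c j * (5 * s j : ℂ)⁻¹
  let e : ℕ → ℂ := fun j => c j * (5 * s j * Complex.I : ℂ)⁻¹
  have hc : Summable fun j => ‖c j‖ := by
    refine Summable.of_nonneg_of_le (fun j => norm_nonneg _) (fun j => ?_) (hα.mul_left ‖κ‖)
    by_cases hj : j = m
    · simp only [c, hj, if_true, norm_zero]
      exact mul_nonneg (norm_nonneg _) (hpos m).le
    · simp only [c, hj, if_false, norm_mul, Complex.norm_real, Real.norm_eq_abs,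
        abs_of_pos (hpos j), le_refl]
  have hle : ∀ j, j ≠ m → (5 * |s j|)⁻¹ ≤ 1 := fun j hj =>
    inv_le_one_of_one_le₀ (by linarith [hs1 j hj])
  have hd : Summable fun j => ‖d j‖ := by
    refine Summable.of_nonneg_of_le (fun j => norm_nonneg _) (fun j => ?_) hc
    by_cases hj : j = m
    · simp [d, c, hj]
    · simp only [d, norm_mul, norm_inv, Complex.norm_real, Real.norm_eq_abs, Complex.norm_ofNat]
      exact mul_le_of_le_one_right (norm_nonneg _) (hle j hj)
  have he : Summable fun j => ‖e j‖ := by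
    refine Summable.of_nonneg_of_le (fun j => norm_nonneg _) (fun j => ?_) hc
    by_cases hj : j = m
    · simp [e, c, hj]
    · simp only [e, norm_mul, norm_inv, Complex.norm_real, Real.norm_eq_abs, Complex.norm_ofNat,
        Complex.norm_I, mul_one]
      exact mul_le_of_le_one_right (norm_nonneg _) (hle j hj)
  let b : ℝ → ℂ := fun ξ => (bw ξ : ℂ)
  let b' : ℝ → ℂ := fun ξ => (bw' ξ : ℂ)
  refine ⟨fun x => (∑' j, c j * osc b (s j) x) + (x : ℂ) * (∑' j, d j * osc b (s j) x)
    + ∑' j, e j * osc b' (s j) x, ?_, fun x => ?_⟩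
  · refine ((contDiff_series cont_b bd_b c hc s).add
      (ContDiff.mul Complex.ofRealCLM.contDiff (contDiff_series cont_b bd_b d hd s))).add
      (contDiff_series cont_b' bd_b' e he s)
  · have H := (((summable_osc (g := b) bd_b c hc s x).hasSum.add
      ((summable_osc (g := b) bd_b d hd s x).hasSum.mul_left (x : ℂ))).add
      (summable_osc (g := b') bd_b' e he s x).hasSum).add
      (hasSum_ite_eq m ((α m : ℂ) * ((Real.exp (-2 * |x|) : ℝ) : ℂ)))
    refine H.congr_fun ?_
    intro j
    by_cases hj : j = m
    · subst hj
      simp only [c, d, e, if_true, zero_mul, mul_zero, add_zero, zero_add]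
      change (α j : ℂ) * Wphi (s j) x = _
      rw [hs0, Wphi_zero]
    · have hsj : s j ≠ 0 := fun h => by have := hs1 j hj; rw [h] at this; norm_num at this
      change (α j : ℂ) * Wphi (s j) x = _
      rw [Wphi_eq, parts _ _ hsj]
      simp only [c, d, e, b, b', hj, if_false, ← hκ]
      ring

end DispBlow


theorem stmt19 (α : ℕ → ℝ) (hpos : ∀ j : ℕ, 0 < α j)
    (hsum : Summable fun j : ℕ => α j * Real.exp (4 * (j + 1))) :
    ∀ n : ℕ, 0 < n →
      (∀ x : ℝ, Summable fun j : ℕ => (α j : ℂ) * Wphi ((n : ℝ) - ((j : ℝ) + 1)) x) ∧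
        ContDiffOn ℝ 1 (fun x : ℝ => ∑' j : ℕ, (α j : ℂ) * Wphi ((n : ℝ) - ((j : ℝ) + 1)) x)
          {x : ℝ | x ≠ 0} ∧
        ¬ ContDiff ℝ 1 (fun x : ℝ => ∑' j : ℕ, (α j : ℂ) * Wphi ((n : ℝ) - ((j : ℝ) + 1)) x) := by
  intro n hn
  obtain ⟨m, rfl⟩ : ∃ m, n = m + 1 := ⟨n - 1, by omega⟩
  obtain ⟨R, hR, hS⟩ := DispBlow.decomposition α hpos hsum m
  have hfun : (fun x : ℝ => ∑' j : ℕ, (α j : ℂ) * Wphi (((m + 1 : ℕ) : ℝ) - ((j : ℝ) + 1)) x)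
      = fun x => R x + (α m : ℂ) * ((Real.exp (-2 * |x|) : ℝ) : ℂ) :=
    funext fun x => (hS x).tsum_eq
  refine ⟨fun x => (hS x).summable, ?_, ?_⟩
  · rw [hfun]
    refine hR.contDiffOn.add (contDiffOn_const.mul ?_)
    intro x hx
    have h1 : ContDiffAt ℝ 1 (fun x : ℝ => Real.exp (-2 * |x|)) x :=
      (contDiffAt_const.mul (contDiffAt_abs hx)).exp
    exact (Complex.ofRealCLM.contDiff.contDiffAt.comp x h1).contDiffWithinAt
  · rw [hfun]
    intro h
    have h1 := (h.sub hR).differentiable one_ne_zero 0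
    have h2 : DifferentiableAt ℝ (fun x : ℝ =>
        Complex.reCLM (R x + (α m : ℂ) * ((Real.exp (-2 * |x|) : ℝ) : ℂ) - R x)) 0 :=
      Complex.reCLM.differentiableAt.comp (0 : ℝ) h1
    have h3 : (fun x : ℝ =>
        Complex.reCLM (R x + (α m : ℂ) * ((Real.exp (-2 * |x|) : ℝ) : ℂ) - R x))
        = fun x => α m * Real.exp (-2 * |x|) := by
      funext x
      rw [add_sub_cancel_left, ← Complex.ofReal_mul, Complex.reCLM_apply, Complex.ofReal_re]
    rw [h3] at h2
    have h4 := ((h2.const_mul (α m)⁻¹).log (by have := hpos m; positivity)).const_mul (-1 / 2)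
    refine not_differentiableAt_abs_zero (h4.congr_of_eventuallyEq (Filter.Eventually.of_forall ?_))
    intro x
    simp only
    rw [inv_mul_cancel_left₀ (hpos m).ne', Real.log_exp]
    ring
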